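/- arXiv:1802.01499 — 6 statements merged into one kernel-verified Lean document; each statement's English description precedes it below -/
import Mathlib

section
/- Let b ∈ ℝ \ ℤ and let π : ℝ → ℝ be a nonnegative function such that (i) π(x) + π(y) ≥ π(x+y) for all x, y ∈ ℝ (subadditivity), (ii) π(x) + π(b − x) = 1 for every x ∈ ℝ (symmetry), and (iii) π(z) = 0 for every z ∈ ℤ. Then π is valid for I_b and minimal. -/
/-- Membership in Gomory's infinite group model `I_b`. -/
def InIb (b : ℝ) (y : ℝ →₀ ℕ) : Prop :=
  ∃ z : ℤ, (∑ x ∈ y.support, (y x : ℝ) * x) - b = (z : ℝ)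

/-- A function `π : ℝ → ℝ` is valid for `I_b`. -/
def IsValid (b : ℝ) (π : ℝ → ℝ) : Prop :=
  ∀ y : ℝ →₀ ℕ, InIb b y → 1 ≤ ∑ x ∈ y.support, π x * (y x : ℝ)

/-- A (nonnegative valid) function `π` is minimal for `I_b` if it is not dominated by another
nonnegative valid function. -/
def IsMinimal (b : ℝ) (π : ℝ → ℝ) : Prop :=
  ¬ ∃ π' : ℝ → ℝ, (∀ x, 0 ≤ π' x) ∧ IsValid b π' ∧ (∀ x, π' x ≤ π x) ∧ π' ≠ π

/-- A subadditive function vanishing at `0` satisfies `π (n * x) ≤ π x * n` for natural `n`. -/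
theorem map_natCast_mul_le_of_subadditive {π : ℝ → ℝ} (h0 : π 0 = 0)
    (hsub : ∀ x y : ℝ, π (x + y) ≤ π x + π y) (n : ℕ) (x : ℝ) :
    π ((n : ℝ) * x) ≤ π x * (n : ℝ) := by
  induction n with
  | zero => simp [h0]
  | succ n ih =>
    have h := hsub ((n : ℝ) * x) x
    rw [Nat.cast_succ, add_one_mul, mul_add_one]
    linarith

theorem isValid_of_subadditive {b : ℝ} {π : ℝ → ℝ}
    (hsub : ∀ x y : ℝ, π (x + y) ≤ π x + π y)
    (hsym : ∀ x : ℝ, π x + π (b - x) = 1)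
    (hint : ∀ z : ℤ, π (z : ℝ) = 0) : IsValid b π := by
  rintro y ⟨z, hz⟩
  have h0 : π 0 = 0 := by simpa using hint 0
  have h1 : π (∑ x ∈ y.support, (y x : ℝ) * x) = 1 := by
    have h := hsym (∑ x ∈ y.support, (y x : ℝ) * x)
    have hz' : b - ∑ x ∈ y.support, (y x : ℝ) * x = ((-z : ℤ) : ℝ) := by
      push_cast
      linarith
    rwa [hz', hint, add_zero] at h
  calc 1 = π (∑ x ∈ y.support, (y x : ℝ) * x) := h1.symm
    _ ≤ ∑ x ∈ y.support, π ((y x : ℝ) * x) := Finset.le_sum_of_subadditive π h0.le hsub _ _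
    _ ≤ ∑ x ∈ y.support, π x * (y x : ℝ) :=
      Finset.sum_le_sum fun x _ => map_natCast_mul_le_of_subadditive h0 hsub _ x

/-- Evaluating a weighted sum at the point of `I_b` with a unit at `u` and a unit at `v`. -/
theorem sum_support_single_add_single (f : ℝ → ℝ) (u v : ℝ) :
    ∑ x ∈ (Finsupp.single u 1 + Finsupp.single v 1 : ℝ →₀ ℕ).support,
      f x * ((Finsupp.single u 1 + Finsupp.single v 1 : ℝ →₀ ℕ) x : ℝ) = f u + f v := by
  change (Finsupp.single u 1 + Finsupp.single v 1 : ℝ →₀ ℕ).sum (fun x n => f x * (n : ℝ)) = _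
  rw [Finsupp.sum_add_index' (by simp) (by intros; push_cast; ring)]
  simp

theorem IsValid.one_le_add {b : ℝ} {π : ℝ → ℝ} (h : IsValid b π) (x : ℝ) :
    1 ≤ π x + π (b - x) := by
  rw [← sum_support_single_add_single]
  refine h _ ⟨0, ?_⟩
  simp_rw [mul_comm]
  rw [sum_support_single_add_single fun t => t]
  simp

theorem isMinimal_of_symmetric {b : ℝ} {π : ℝ → ℝ}
    (hsym : ∀ x : ℝ, π x + π (b - x) = 1) : IsMinimal b π := by
  rintro ⟨π', -, hvalid, hle, hne⟩
  refine hne (funext fun x => le_antisymm (hle x) ?_)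
  linarith [hvalid.one_le_add x, hsym x, hle (b - x)]

theorem minimal_characterization_backward (b : ℝ) (hb : ∀ z : ℤ, b ≠ (z : ℝ))
    (π : ℝ → ℝ) (hnn : ∀ x, 0 ≤ π x)
    (hsub : ∀ x y : ℝ, π (x + y) ≤ π x + π y)
    (hsym : ∀ x : ℝ, π x + π (b - x) = 1)
    (hint : ∀ z : ℤ, π (z : ℝ) = 0) :
    IsValid b π ∧ IsMinimal b π := by
  exact ⟨isValid_of_subadditive hsub hsym hint, isMinimal_of_symmetric hsym⟩
end

section
/- Let b ∈ ℝ \ ℤ and let π : ℝ → ℝ be a nonnegative valid function for I_b that is minimal. Then π(b) = 1 and π is periodic modulo 1, i.e., π(x + z) = π(x) for every x ∈ ℝ and every z ∈ ℤ. -/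
/-- Capping a nonnegative valid function at the value `1` at the point `b` keeps it valid. -/
theorem IsValid.update_one {b : ℝ} {π : ℝ → ℝ} (hval : IsValid b π) (hnn : ∀ x, 0 ≤ π x) :
    IsValid b (Function.update π b 1) := by
  intro y hy
  by_cases hby : b ∈ y.support
  · have hnn' : ∀ x ∈ y.support, 0 ≤ Function.update π b 1 x * (y x : ℝ) := fun x _ =>
      mul_nonneg (by by_cases h : x = b <;> simp [h, hnn]) (Nat.cast_nonneg _)
    refine le_trans ?_ (Finset.single_le_sum hnn' hby)
    have : 1 ≤ y b := Nat.one_le_iff_ne_zero.2 (Finsupp.mem_support_iff.1 hby)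
    simpa using this
  · refine (hval y hy).trans_eq (Finset.sum_congr rfl fun x hx => ?_)
    rw [Function.update_of_ne (ne_of_mem_of_not_mem hx hby)]

/-- Moving the mass of a point of `I_b` along integer translations stays in `I_b`. -/
theorem InIb.mapDomain {b : ℝ} {y : ℝ →₀ ℕ} (hy : InIb b y) {f : ℝ → ℝ} {k : ℝ → ℤ}
    (hf : ∀ x, f x = x + k x) : InIb b (y.mapDomain f) := by
  obtain ⟨z, hz⟩ := hy
  have hsum : ∑ x ∈ (y.mapDomain f).support, ((y.mapDomain f) x : ℝ) * x =
      ∑ x ∈ y.support, (y x : ℝ) * f x :=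
    Finsupp.sum_mapDomain_index (h := fun x (n : ℕ) => (n : ℝ) * x) (by simp)
      (by intros; push_cast; ring)
  refine ⟨z + ∑ x ∈ y.support, (y x : ℤ) * k x, ?_⟩
  rw [hsum]
  push_cast
  rw [← hz]
  simp only [hf, mul_add, Finset.sum_add_distrib]
  ring

/-- Validity is preserved by precomposing with pointwise integer translations. -/
theorem IsValid.comp_translate {b : ℝ} {π : ℝ → ℝ} (hval : IsValid b π) {f : ℝ → ℝ}
    {k : ℝ → ℤ} (hf : ∀ x, f x = x + k x) : IsValid b (π ∘ f) := by
  intro y hy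
  refine (hval _ (hy.mapDomain hf)).trans_eq ?_
  exact Finsupp.sum_mapDomain_index (h := fun x (n : ℕ) => π x * (n : ℝ)) (by simp)
    (by intros; push_cast; ring)

theorem IsMinimal.le_translate {b : ℝ} {π : ℝ → ℝ} (hmin : IsMinimal b π)
    (hnn : ∀ x, 0 ≤ π x) (hval : IsValid b π) (x : ℝ) (z : ℤ) : π x ≤ π (x + z) := by
  by_contra! hlt
  let k : ℝ → ℤ := Function.update 0 x z
  refine hmin ⟨π ∘ fun t => t + k t, fun t => hnn _, hval.comp_translate fun _ => rfl,
    fun t => ?_, fun h => ?_⟩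
  · by_cases ht : t = x
    · subst ht
      simpa [k] using hlt.le
    · simp [k, ht]
  · have := congrFun h x
    simp only [Function.comp_apply, k, Function.update_self] at this
    exact hlt.ne this

theorem minimal_implies_value_at_b_and_periodic (b : ℝ) (hb : ∀ z : ℤ, b ≠ (z : ℝ))
    (π : ℝ → ℝ) (hnn : ∀ x, 0 ≤ π x) (hval : IsValid b π) (hmin : IsMinimal b π) :
    π b = 1 ∧ ∀ (x : ℝ) (z : ℤ), π (x + (z : ℝ)) = π x := by
  refine ⟨?_, fun x z => le_antisymm ?_ (hmin.le_translate hnn hval x z)⟩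
  · have hge : 1 ≤ π b := by
      have hsingle : (Finsupp.single b 1 : ℝ →₀ ℕ).support = {b} :=
        Finsupp.support_single _ one_ne_zero
      simpa [hsingle] using hval (Finsupp.single b 1) ⟨0, by simp⟩
    by_contra hne
    refine hmin ⟨Function.update π b 1, fun x => ?_, hval.update_one hnn, fun x => ?_,
      fun h => hne ?_⟩
    · by_cases h : x = b <;> simp [h, hnn]
    · by_cases h : x = b <;> simp [h, hge]
    · simpa using (congrFun h b).symm
  · simpa using hmin.le_translate hnn hval (x + z) (-z)
end

section
/- Let b ∈ ℝ \ ℤ. For every nonnegative valid function π for I_b there exists a nonnegative valid function π' for I_b such that π' ≤ π pointwise and π' is minimal. -/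
/-- The pointwise infimum of a codirected family of nonnegative valid functions is valid. -/
theorem IsValid.iInf {b : ℝ} {ι : Type*} [Preorder ι] [IsCodirectedOrder ι] [Nonempty ι]
    {f : ι → ℝ → ℝ} (hmono : Monotone f) (hnn : ∀ i x, 0 ≤ f i x) (hval : ∀ i, IsValid b (f i)) :
    IsValid b fun x => ⨅ i, f i x := by
  intro y hy
  refine ge_of_tendsto' (tendsto_finsetSum (x := Filter.atBot) y.support fun x _ => ?_) fun i => hval i y hy
  refine (tendsto_atBot_ciInf (fun i j hij => hmono hij x) ?_).mul_const _
  exact ⟨0, Set.forall_mem_range.2 fun i => hnn i x⟩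

theorem exists_minimal_dominating (b : ℝ) (hb : ∀ z : ℤ, b ≠ (z : ℝ))
    (π : ℝ → ℝ) (hnn : ∀ x, 0 ≤ π x) (hval : IsValid b π) :
    ∃ π' : ℝ → ℝ, (∀ x, 0 ≤ π' x) ∧ IsValid b π' ∧ (∀ x, π' x ≤ π x) ∧ IsMinimal b π' := by
  let S : Set (ℝ → ℝ)ᵒᵈ := {f | (∀ x, 0 ≤ f.ofDual x) ∧ IsValid b f.ofDual}
  have hchain : ∀ c ⊆ S, IsChain (· ≤ ·) c → ∀ f ∈ c, ∃ ub ∈ S, ∀ g ∈ c, g ≤ ub := by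
    intro c hcS hc f hf
    let ι : Type := {g : ℝ → ℝ // OrderDual.toDual g ∈ c}
    have : Nonempty ι := ⟨⟨f.ofDual, hf⟩⟩
    have : IsCodirectedOrder ι := ⟨fun g h =>
      (hc.total g.2 h.2).elim (fun hgh => ⟨h, hgh, le_rfl⟩) fun hhg => ⟨g, le_rfl, hhg⟩⟩
    have hnonneg (g : ι) (x : ℝ) : 0 ≤ g.1 x := (hcS g.2).1 x
    refine ⟨OrderDual.toDual fun x => ⨅ g : ι, g.1 x, ⟨fun x => ?_, ?_⟩, fun g hg x => ?_⟩
    · exact Real.iInf_nonneg fun g => hnonneg g x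
    · exact IsValid.iInf (f := fun g : ι => g.1) (fun _ _ h => h) hnonneg fun g => (hcS g.2).2
    · exact ciInf_le ⟨0, Set.forall_mem_range.2 fun g : ι => hnonneg g x⟩ (⟨g.ofDual, hg⟩ : ι)
  obtain ⟨m, hm, ⟨hm_nonneg, hm_valid⟩, hmax⟩ :=
    zorn_le_nonempty₀ S hchain (OrderDual.toDual π) ⟨hnn, hval⟩
  refine ⟨m.ofDual, hm_nonneg, hm_valid, hm, ?_⟩
  rintro ⟨g, hg_nonneg, hg_valid, hle, hne⟩
  exact hne (le_antisymm hle (hmax (y := OrderDual.toDual g) ⟨hg_nonneg, hg_valid⟩ hle))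
end

section
/- Let b ∈ ℝ \ ℤ. Every nonnegative valid function for I_b that is extreme is also minimal. -/
/-- A pointwise larger function than a valid one is valid. -/
theorem IsValid.mono {b : ℝ} {π ρ : ℝ → ℝ} (h : IsValid b π) (hle : ∀ x, π x ≤ ρ x) :
    IsValid b ρ := fun y hy =>
  (h y hy).trans (Finset.sum_le_sum fun x _ =>
    mul_le_mul_of_nonneg_right (hle x) (Nat.cast_nonneg _))

theorem extreme_implies_minimal (b : ℝ) (hb : ∀ z : ℤ, b ≠ (z : ℝ))
    (π : ℝ → ℝ) (hnn : ∀ x, 0 ≤ π x) (hval : IsValid b π)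
    (hext : ∀ π₁ π₂ : ℝ → ℝ, (∀ x, 0 ≤ π₁ x) → IsValid b π₁ →
      (∀ x, 0 ≤ π₂ x) → IsValid b π₂ →
      (∀ x, π x = (1 / 2) * π₁ x + (1 / 2) * π₂ x) → π₁ = π₂) :
    IsMinimal b π := by
  rintro ⟨ρ, hρ_nonneg, hρ_valid, hle, hne⟩
  have heq : ρ = fun x => 2 * π x - ρ x :=
    hext ρ _ hρ_nonneg hρ_valid (fun x => by linarith [hnn x, hle x])
      (hval.mono fun x => by linarith [hle x]) (fun x => by ring)
  exact hne (funext fun x => by linarith [congrFun heq x])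
end

section
/- Let b ∈ ℝ \ ℤ. The affine hull (over ℝ) of I_b, viewed as a subset of the space ℝ →₀ ℝ of finitely supported real-valued functions on ℝ, equals the set of all y ∈ ℝ →₀ ℝ satisfying ∑_{p ∈ support y} θ(p)·y(p) = θ(b) for every additive function θ : ℝ → ℝ such that θ(p) = 0 for every p ∈ ℚ. -/
/-- The natural inclusion of `ℝ →₀ ℕ` into `ℝ →₀ ℝ`. -/
noncomputable def toRealFinsupp (y : ℝ →₀ ℕ) : ℝ →₀ ℝ :=
  Finsupp.mapRange (fun n : ℕ => (n : ℝ)) (by simp) y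

theorem toRealFinsupp_single (x : ℝ) (n : ℕ) :
    toRealFinsupp (Finsupp.single x n) = Finsupp.single x (n : ℝ) := by
  simp [toRealFinsupp]

theorem toRealFinsupp_add (y z : ℝ →₀ ℕ) :
    toRealFinsupp (y + z) = toRealFinsupp y + toRealFinsupp z := by
  ext x
  simp [toRealFinsupp]

theorem inIb_iff_linearCombination (b : ℝ) (y : ℝ →₀ ℕ) :
    InIb b y ↔ ∃ z : ℤ, Finsupp.linearCombination ℕ (id : ℝ → ℝ) y - b = z := by
  simp [InIb, Finsupp.linearCombination_apply, Finsupp.sum]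

theorem sum_support_eq_linearCombination (θ : ℝ → ℝ) (v : ℝ →₀ ℝ) :
    ∑ p ∈ v.support, θ p * v p = Finsupp.linearCombination ℝ θ v := by
  simp [Finsupp.linearCombination_apply, Finsupp.sum, mul_comm]

theorem linearCombination_toRealFinsupp (θ : ℝ →+ ℝ) (y : ℝ →₀ ℕ) :
    Finsupp.linearCombination ℝ θ (toRealFinsupp y) =
      θ (Finsupp.linearCombination ℕ (id : ℝ → ℝ) y) := by
  induction y using Finsupp.induction_linear with
  | zero => simp [toRealFinsupp]
  | add y z hy hz => rw [toRealFinsupp_add, map_add, map_add, map_add, hy, hz]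
  | single x n =>
    rw [toRealFinsupp_single, Finsupp.linearCombination_single, Finsupp.linearCombination_single,
      map_nsmul]
    simp

/-- The direction of the affine hull of `I_b` contains every nonnegative integer combination whose
total is an integer. -/
theorem toRealFinsupp_mem_direction (b : ℝ) (y : ℝ →₀ ℕ)
    (hy : ∃ z : ℤ, Finsupp.linearCombination ℕ (id : ℝ → ℝ) y = z) :
    toRealFinsupp y ∈
      (affineSpan ℝ {v : ℝ →₀ ℝ | ∃ y : ℝ →₀ ℕ, InIb b y ∧ v = toRealFinsupp y}).direction := by
  obtain ⟨z, hz⟩ := hy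
  have hmem : toRealFinsupp (y + Finsupp.single b 1) -ᵥ toRealFinsupp (Finsupp.single b 1) ∈
      (affineSpan ℝ {v : ℝ →₀ ℝ | ∃ y : ℝ →₀ ℕ, InIb b y ∧ v = toRealFinsupp y}).direction := by
    refine AffineSubspace.vsub_mem_direction (subset_affineSpan ℝ _ ⟨_, ?_, rfl⟩)
      (subset_affineSpan ℝ _ ⟨_, ?_, rfl⟩)
    · exact (inIb_iff_linearCombination _ _).2 ⟨z, by simp [hz]⟩
    · exact (inIb_iff_linearCombination _ _).2 ⟨0, by simp⟩
  simpa [toRealFinsupp_add] using hmem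

theorem affine_hull_of_Ib (b : ℝ) (hb : ∀ z : ℤ, b ≠ (z : ℝ)) :
    (affineSpan ℝ {v : ℝ →₀ ℝ | ∃ y : ℝ →₀ ℕ, InIb b y ∧ v = toRealFinsupp y} :
      Set (ℝ →₀ ℝ)) =
    {v : ℝ →₀ ℝ | ∀ θ : ℝ → ℝ, (∀ u w : ℝ, θ (u + w) = θ u + θ w) →
      (∀ q : ℚ, θ (q : ℝ) = 0) → ∑ p ∈ v.support, θ p * v p = θ b} := by
  simp only [sum_support_eq_linearCombination]
  ext v
  constructor
  · intro hv θ hadd hrat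
    refine affineSpan_induction
      (p := fun v => Finsupp.linearCombination ℝ θ v = θ b) hv ?_ ?_
    · rintro _ ⟨y, hy, rfl⟩
      obtain ⟨z, hz⟩ := (inIb_iff_linearCombination b y).1 hy
      have h := linearCombination_toRealFinsupp (AddMonoidHom.mk' θ hadd) y
      have hz0 : θ z = 0 := by simpa using hrat z
      rw [sub_eq_iff_eq_add.1 hz] at h
      simpa [hadd, hz0] using h
    · intro c u w x hu hw hx
      simp [hu, hw, hx]
  · intro hv
    by_contra hmem
    have hb_mem : Finsupp.single b (1 : ℝ) ∈
        affineSpan ℝ {v : ℝ →₀ ℝ | ∃ y : ℝ →₀ ℕ, InIb b y ∧ v = toRealFinsupp y} :=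
      subset_affineSpan ℝ _ ⟨Finsupp.single b 1,
        (inIb_iff_linearCombination _ _).2 ⟨0, by simp⟩, by simp [toRealFinsupp_single]⟩
    have hnot : v - Finsupp.single b (1 : ℝ) ∉ (affineSpan ℝ
        {v : ℝ →₀ ℝ | ∃ y : ℝ →₀ ℕ, InIb b y ∧ v = toRealFinsupp y}).direction := fun h =>
      hmem ((AffineSubspace.vsub_right_mem_direction_iff_mem hb_mem v).1 h)
    obtain ⟨f, hf, hker⟩ := Submodule.exists_le_ker_of_notMem hnot
    have hzero (y : ℝ →₀ ℕ) (hy : ∃ z : ℤ, Finsupp.linearCombination ℕ (id : ℝ → ℝ) y = z) :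
        f (toRealFinsupp y) = 0 :=
      hker (toRealFinsupp_mem_direction b y hy)
    have hneg (x : ℝ) : f (Finsupp.single x 1) + f (Finsupp.single (-x) 1) = 0 := by
      have h2 := hzero (Finsupp.single x 1 + Finsupp.single (-x) 1) ⟨0, by simp⟩
      simpa only [toRealFinsupp_add, toRealFinsupp_single, map_add, Nat.cast_one] using h2
    have hcomb : Finsupp.linearCombination ℝ (fun x => f (Finsupp.single x 1)) = f := by
      ext x
      simp
    have h := hv (fun x => f (Finsupp.single x 1)) ?_ ?_
    · rw [hcomb] at h
      exact hf (by rw [map_sub, h, sub_self])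
    · intro u w
      have h3 := hzero (Finsupp.single u 1 + Finsupp.single w 1 + Finsupp.single (-(u + w)) 1)
        ⟨0, by simp [-neg_add_rev]⟩
      simp only [toRealFinsupp_add, toRealFinsupp_single, map_add, Nat.cast_one] at h3
      linarith [hneg (u + w)]
    · intro q
      have hq := hzero (Finsupp.single (q : ℝ) q.den)
        ⟨q.num, by simpa using mod_cast Rat.den_mul_eq_num q⟩
      rw [toRealFinsupp_single, ← mul_one (q.den : ℝ), ← smul_eq_mul, ← Finsupp.smul_single,
        map_smul, smul_eq_mul] at hq
      exact (mul_eq_zero.1 hq).resolve_left (by exact_mod_cast q.den_nz)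
end

section
/- Let b ∈ ℚ \ ℤ. For every function π : ℝ → ℝ that is valid for I_b (not necessarily nonnegative), there exists an additive function θ : ℝ → ℝ with θ(p) = 0 for every p ∈ ℚ such that the function π' := π + θ is valid for I_b and satisfies π'(x) ≥ 0 for all x ∈ ℝ. -/
/-- The one-step extension in the M. Riesz extension theorem over `ℚ`, with real values. -/
theorem exists_lt_linearPMap_nonneg {E : Type*} [AddCommGroup E] [Module ℚ E] (s : PointedCone ℚ E)
    (f : E →ₗ.[ℚ] ℝ) (nonneg : ∀ x : f.domain, (x : E) ∈ s → 0 ≤ f x)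
    (dense : ∀ y, ∃ x : f.domain, (x : E) + y ∈ s) (hdom : f.domain ≠ ⊤) :
    ∃ g, f < g ∧ ∀ x : g.domain, (x : E) ∈ s → 0 ≤ g x := by
  obtain ⟨y, -, hy⟩ : ∃ y ∈ ⊤, y ∉ f.domain := SetLike.exists_of_lt (lt_top_iff_ne_top.2 hdom)
  obtain ⟨c, le_c, c_le⟩ :
      ∃ c, (∀ x : f.domain, -(x : E) - y ∈ s → f x ≤ c) ∧
        ∀ x : f.domain, (x : E) + y ∈ s → c ≤ f x := by
    set Sp := f '' { x : f.domain | (x : E) + y ∈ s }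
    set Sn := f '' { x : f.domain | -(x : E) - y ∈ s }
    suffices (upperBounds Sn ∩ lowerBounds Sp).Nonempty by
      simpa only [Sp, Sn, Set.Nonempty, upperBounds, lowerBounds, Set.forall_mem_image] using! this
    refine exists_between_of_forall_le (Set.Nonempty.image f ?_) (Set.Nonempty.image f (dense y)) ?_
    · rcases dense (-y) with ⟨x, hx⟩
      rw [← neg_neg x, NegMemClass.coe_neg, ← sub_eq_add_neg] at hx
      exact ⟨_, hx⟩
    rintro a ⟨xn, hxn, rfl⟩ b ⟨xp, hxp, rfl⟩
    have := s.add_mem hxp hxn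
    rw [add_assoc, add_sub_cancel, ← sub_eq_add_neg, ← AddSubgroupClass.coe_sub] at this
    replace := nonneg _ this
    rwa [f.map_sub, sub_nonneg] at this
  refine ⟨f.supSpanSingleton y (-c) hy, ?_, ?_⟩
  · refine lt_iff_le_not_ge.2 ⟨f.left_le_sup _ _, fun H => ?_⟩
    replace H := LinearPMap.domain_mono.monotone H
    rw [LinearPMap.domain_supSpanSingleton, sup_le_iff, Submodule.span_le,
      Set.singleton_subset_iff] at H
    exact hy H.2
  · rintro ⟨z, hz⟩ hzs
    rcases Submodule.mem_sup.1 hz with ⟨x, hx, y', hy', rfl⟩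
    rcases Submodule.mem_span_singleton.1 hy' with ⟨r, rfl⟩
    simp only at hzs
    rw [LinearPMap.supSpanSingleton_apply_mk _ _ _ _ _ hx, smul_neg, ← sub_eq_add_neg, sub_nonneg]
    rcases lt_trichotomy r 0 with (hr | hr | hr)
    · have : -(r⁻¹ • x) - y ∈ s := by
        rwa [← s.smul_mem_iff (neg_pos.2 hr), smul_sub, smul_neg, neg_smul, neg_neg, smul_smul,
          mul_inv_cancel₀ hr.ne, one_smul, sub_eq_add_neg, neg_smul, neg_neg]
      replace := le_c (r⁻¹ • ⟨x, hx⟩) this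
      have h := smul_le_smul_of_nonneg_left this (neg_pos.2 hr).le
      rwa [neg_smul, neg_smul, neg_le_neg_iff, f.map_smul, smul_smul, mul_inv_cancel₀ hr.ne,
        one_smul] at h
    · subst r
      simp only [zero_smul, add_zero] at hzs ⊢
      rw [RingHom.id_apply, zero_smul]
      apply nonneg
      exact hzs
    · have : r⁻¹ • x + y ∈ s := by
        rwa [← s.smul_mem_iff hr, smul_add, smul_smul, mul_inv_cancel₀ hr.ne', one_smul]
      replace := c_le (r⁻¹ • ⟨x, hx⟩) this
      have h := smul_le_smul_of_nonneg_left this hr.le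
      rwa [f.map_smul, smul_smul, mul_inv_cancel₀ hr.ne', one_smul] at h

/-- A maximal nonnegative extension, obtained from Zorn's lemma, is defined everywhere. -/
theorem exists_domain_eq_top_linearPMap_nonneg {E : Type*} [AddCommGroup E] [Module ℚ E]
    (s : PointedCone ℚ E) (p : E →ₗ.[ℚ] ℝ)
    (hp_nonneg : ∀ x : p.domain, (x : E) ∈ s → 0 ≤ p x)
    (hp_dense : ∀ y, ∃ x : p.domain, (x : E) + y ∈ s) :
    ∃ q ≥ p, q.domain = ⊤ ∧ ∀ x : q.domain, (x : E) ∈ s → 0 ≤ q x := by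
  set S := { p : E →ₗ.[ℚ] ℝ | ∀ x : p.domain, (x : E) ∈ s → 0 ≤ p x }
  have hSc : ∀ c, c ⊆ S → IsChain (· ≤ ·) c → ∀ y ∈ c, ∃ ub ∈ S, ∀ z ∈ c, z ≤ ub := by
    intro c hcs c_chain y hy
    clear hp_nonneg hp_dense p
    have cne : c.Nonempty := ⟨y, hy⟩
    have hcd : DirectedOn (· ≤ ·) c := c_chain.directedOn
    refine ⟨LinearPMap.sSup c hcd, ?_, fun _ ↦ LinearPMap.le_sSup hcd⟩
    rintro ⟨x, hx⟩ hxs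
    have hdir : DirectedOn (· ≤ ·) (LinearPMap.domain '' c) :=
      directedOn_image.2 (hcd.mono LinearPMap.domain_mono.monotone)
    rcases (Submodule.mem_sSup_of_directed (cne.image _) hdir).1 hx with ⟨_, ⟨f, hfc, rfl⟩, hfx⟩
    have : f ≤ LinearPMap.sSup c hcd := LinearPMap.le_sSup _ hfc
    convert! ← hcs hfc ⟨x, hfx⟩ hxs using 1
    exact this.2 rfl
  obtain ⟨q, hpq, hqs, hq⟩ := zorn_le_nonempty₀ S hSc p hp_nonneg
  refine ⟨q, hpq, ?_, hqs⟩
  contrapose! hq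
  have hqd : ∀ y, ∃ x : q.domain, (x : E) + y ∈ s := fun y ↦
    let ⟨x, hx⟩ := hp_dense y
    ⟨Submodule.inclusion hpq.left x, hx⟩
  rcases exists_lt_linearPMap_nonneg s q hqs hqd hq with ⟨r, hqr, hr⟩
  exact ⟨r, hr, hqr.le, fun hrq ↦ hqr.ne' <| hrq.antisymm hqr.le⟩

/-- **M. Riesz extension theorem** over `ℚ`, for functionals with real values. -/
theorem riesz_extension_rat {E : Type*} [AddCommGroup E] [Module ℚ E] (s : PointedCone ℚ E)
    (f : E →ₗ.[ℚ] ℝ) (nonneg : ∀ x : f.domain, (x : E) ∈ s → 0 ≤ f x)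
    (dense : ∀ y, ∃ x : f.domain, (x : E) + y ∈ s) :
    ∃ g : E →ₗ[ℚ] ℝ, (∀ x : f.domain, g x = f x) ∧ ∀ x ∈ s, 0 ≤ g x := by
  rcases exists_domain_eq_top_linearPMap_nonneg s f nonneg dense
    with ⟨⟨g_dom, g⟩, ⟨-, hfg⟩, rfl : g_dom = ⊤, hgs⟩
  refine ⟨g.comp (LinearMap.id.codRestrict ⊤ fun _ ↦ trivial), ?_, ?_⟩
  · exact fun x => (hfg rfl).symm
  · exact fun x hx => hgs ⟨x, _⟩ hx

theorem linearCombination_rat_mapRange_natCast (v : ℝ → ℝ) (y : ℝ →₀ ℕ) :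
    Finsupp.linearCombination ℚ v (y.mapRange (Nat.cast : ℕ → ℚ) Nat.cast_zero) =
      Finsupp.linearCombination ℕ v y := by
  rw [Finsupp.linearCombination_apply, Finsupp.linearCombination_apply,
    Finsupp.sum_mapRange_index (by simp)]
  simp [Rat.smul_def]

theorem isValid_iff_linearCombination (b : ℝ) (π : ℝ → ℝ) :
    IsValid b π ↔ ∀ y, InIb b y → 1 ≤ Finsupp.linearCombination ℕ π y := by
  simp [IsValid, Finsupp.linearCombination_apply, Finsupp.sum, mul_comm]

/-- Clearing denominators in a nonnegative rational combination. -/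
theorem exists_pos_smul_eq_mapRange_natCast {α : Type*} (x : α →₀ ℚ) (hx : ∀ r, 0 ≤ x r) :
    ∃ N : ℕ, 0 < N ∧ ∃ y : α →₀ ℕ, (N : ℚ) • x = y.mapRange (Nat.cast : ℕ → ℚ) Nat.cast_zero := by
  set N : ℕ := ∏ r ∈ x.support, (x r).den with hN
  refine ⟨N, Finset.prod_pos fun r _ => (x r).den_pos,
    x.mapRange (fun t => ((N : ℚ) * t).num.toNat) (by simp), ?_⟩
  ext r
  simp only [Finsupp.smul_apply, smul_eq_mul, Finsupp.mapRange_apply]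
  by_cases hr : r ∈ x.support
  · obtain ⟨M, hM⟩ : (x r).den ∣ N := Finset.dvd_prod_of_mem (fun r => (x r).den) hr
    have hnum : (N : ℚ) * x r = ((M * (x r).num : ℤ) : ℚ) := by
      rw [hM]
      push_cast
      rw [mul_comm ((x r).den : ℚ), mul_assoc, mul_comm ((x r).den : ℚ), Rat.mul_den_eq_num]
    have hnonneg : 0 ≤ (M * (x r).num : ℤ) :=
      mul_nonneg (Int.natCast_nonneg M) (Rat.num_nonneg.2 (hx r))
    rw [hnum, Rat.num_intCast]
    exact_mod_cast (Int.toNat_of_nonneg hnonneg).symm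
  · simp [Finsupp.notMem_support_iff.1 hr]

/-- A valid function is nonnegative on natural combinations with integer sum. -/
theorem IsValid.linearCombination_nonneg_of_int {b : ℝ} {π : ℝ → ℝ} (hval : IsValid b π)
    (y : ℝ →₀ ℕ) (z : ℤ) (hz : Finsupp.linearCombination ℕ (id : ℝ → ℝ) y = z) :
    0 ≤ Finsupp.linearCombination ℕ π y := by
  by_contra! hneg
  obtain ⟨k, hk⟩ := Archimedean.arch (π b) (neg_pos.2 hneg)
  have h := (isValid_iff_linearCombination b π).1 hval (k • y + Finsupp.single b 1)
    ((inIb_iff_linearCombination _ _).2 ⟨k * z, by simp [hz]⟩)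
  simp only [map_add, map_nsmul, Finsupp.linearCombination_single, one_smul] at h
  rw [smul_neg] at hk
  linarith

/-- A valid function is nonnegative on nonnegative rational combinations with rational sum. -/
theorem IsValid.linearCombination_nonneg_of_rat {b : ℝ} {π : ℝ → ℝ} (hval : IsValid b π)
    (x : ℝ →₀ ℚ) (hx : ∀ r, 0 ≤ x r) (q : ℚ)
    (hq : Finsupp.linearCombination ℚ (id : ℝ → ℝ) x = q) :
    0 ≤ Finsupp.linearCombination ℚ π x := by
  obtain ⟨N, hN, y, hy⟩ := exists_pos_smul_eq_mapRange_natCast x hx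
  have hsum : Finsupp.linearCombination ℕ (id : ℝ → ℝ) (q.den • y) = ((N * q.num : ℤ) : ℝ) := by
    rw [map_nsmul, ← linearCombination_rat_mapRange_natCast, ← hy, map_smul, hq, Rat.smul_def,
      nsmul_eq_mul]
    have : (q : ℝ) * q.den = q.num := by exact_mod_cast Rat.mul_den_eq_num q
    push_cast
    linear_combination (N : ℝ) * this
  have h := hval.linearCombination_nonneg_of_int _ _ hsum
  rw [map_nsmul, ← linearCombination_rat_mapRange_natCast, ← hy, map_smul, Rat.smul_def,
    nsmul_eq_mul] at h
  have hden : (0 : ℝ) < q.den := by exact_mod_cast q.den_pos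
  have hN' : (0 : ℝ) < ((N : ℚ) : ℝ) := by exact_mod_cast hN
  exact nonneg_of_mul_nonneg_right (nonneg_of_mul_nonneg_right h hden) hN'

/-- The cone of nonnegative finitely supported rational functions. -/
def nonnegRatCone (α : Type*) : PointedCone ℚ (α →₀ ℚ) where
  carrier := {x | ∀ r, 0 ≤ x r}
  zero_mem' := fun _ => le_rfl
  add_mem' := fun hx hy r => add_nonneg (hx r) (hy r)
  smul_mem' := fun c _ hx r => mul_nonneg c.2 (hx r)

/-- Rational combinations of real numbers with rational sum. -/
noncomputable def ratSumSubmodule : Submodule ℚ (ℝ →₀ ℚ) :=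
  (Submodule.span ℚ {(1 : ℝ)}).comap (Finsupp.linearCombination ℚ (id : ℝ → ℝ))

theorem mem_ratSumSubmodule {x : ℝ →₀ ℚ} :
    x ∈ ratSumSubmodule ↔ ∃ q : ℚ, Finsupp.linearCombination ℚ (id : ℝ → ℝ) x = q := by
  simp [ratSumSubmodule, Submodule.mem_span_singleton, Rat.smul_def, eq_comm]

theorem exists_ratSumSubmodule_add_mem_nonnegRatCone (y : ℝ →₀ ℚ) :
    ∃ x ∈ ratSumSubmodule, x + y ∈ nonnegRatCone ℝ := by
  induction y using Finsupp.induction_linear with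
  | zero => exact ⟨0, zero_mem _, by simp⟩
  | add y₁ y₂ h₁ h₂ =>
    obtain ⟨x₁, hx₁, hs₁⟩ := h₁
    obtain ⟨x₂, hx₂, hs₂⟩ := h₂
    exact ⟨x₁ + x₂, add_mem hx₁ hx₂, by
      rw [add_add_add_comm]; exact add_mem hs₁ hs₂⟩
  | single a c =>
    refine ⟨Finsupp.single a |c| + Finsupp.single (-a) |c|, mem_ratSumSubmodule.2 ⟨0, by simp⟩,
      fun r => ?_⟩
    have h := neg_abs_le c
    have h' := abs_nonneg c
    simp only [Finsupp.add_apply, Finsupp.single_apply]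
    split_ifs <;> linarith

theorem valid_function_has_nonnegative_form (b : ℝ) (hbq : ∃ q : ℚ, b = (q : ℝ))
    (hb : ∀ z : ℤ, b ≠ (z : ℝ)) (π : ℝ → ℝ) (hval : IsValid b π) :
    ∃ θ : ℝ → ℝ, (∀ u v : ℝ, θ (u + v) = θ u + θ v) ∧ (∀ q : ℚ, θ (q : ℝ) = 0) ∧
      IsValid b (fun x => π x + θ x) ∧ (∀ x : ℝ, 0 ≤ π x + θ x) := by
  obtain ⟨b', rfl⟩ := hbq
  obtain ⟨g, hg, hgs⟩ := riesz_extension_rat (nonnegRatCone ℝ)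
    ⟨ratSumSubmodule, (Finsupp.linearCombination ℚ π).domRestrict ratSumSubmodule⟩
    (by
      rintro ⟨x, hx⟩ hxs
      obtain ⟨q, hq⟩ := mem_ratSumSubmodule.1 hx
      exact hval.linearCombination_nonneg_of_rat x hxs q hq)
    (fun y => by
      obtain ⟨x, hx, hxy⟩ := exists_ratSumSubmodule_add_mem_nonnegRatCone y
      exact ⟨⟨x, hx⟩, hxy⟩)
  have hg' : ∀ x q, Finsupp.linearCombination ℚ (id : ℝ → ℝ) x = ((q : ℚ) : ℝ) →
      g x = Finsupp.linearCombination ℚ π x :=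
    fun x q hx => hg ⟨x, mem_ratSumSubmodule.2 ⟨q, hx⟩⟩
  refine ⟨fun x => g (Finsupp.single x 1) - π x, fun u v => ?_, fun q => ?_, ?_, fun x => ?_⟩
  · have h := hg' (Finsupp.single (u + v) 1 - Finsupp.single u 1 - Finsupp.single v 1) 0 (by simp)
    simp only [map_sub, Finsupp.linearCombination_single, one_smul] at h
    linarith
  · have h := hg' (Finsupp.single (q : ℝ) 1) q (by simp)
    simp [h]
  · rw [isValid_iff_linearCombination] at hval ⊢
    intro y hy
    obtain ⟨z, hz⟩ := (inIb_iff_linearCombination _ _).1 hy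
    have h := hg' (y.mapRange (Nat.cast : ℕ → ℚ) Nat.cast_zero) (b' + z) (by
      rw [linearCombination_rat_mapRange_natCast]
      push_cast
      linarith)
    rw [linearCombination_rat_mapRange_natCast] at h
    have hsum : g (y.mapRange (Nat.cast : ℕ → ℚ) Nat.cast_zero) =
        Finsupp.linearCombination ℕ (fun x => g (Finsupp.single x 1)) y := by
      rw [← linearCombination_rat_mapRange_natCast, Finsupp.linearCombination_apply]
      conv_lhs => rw [← Finsupp.sum_single (y.mapRange (Nat.cast : ℕ → ℚ) Nat.cast_zero)]
      rw [map_finsuppSum]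
      refine Finsupp.sum_congr fun x _ => ?_
      rw [← map_smul, Finsupp.smul_single, smul_eq_mul, mul_one]
    simp only [add_sub_cancel]
    rw [← hsum, h]
    exact hval y hy
  · rw [add_sub_cancel]
    refine hgs _ fun r => ?_
    rw [Finsupp.single_apply]
    split_ifs <;> norm_num
end
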